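/- Let p be an odd prime and ε ∈ ℤ_p^×. Let T₁, …, T_u be pairwise non-ℤ-equivalent positive definite half-integral ternary forms, mutually ℤ_q-equivalent at every prime q, with Gram matrices ℤ_p-equivalent to H ⊕ [ε]. Let S₁, …, S_v be pairwise non-ℤ-equivalent positive definite half-integral ternary forms with Gram matrices ℤ_p-equivalent to H ⊕ [pε] and ℤ_q-equivalent to p·Gram(T₁) at every prime q ≠ p. Assume the two closure conditions: (i) for every j and every subgroup N ≤ ℤ³ of index p on which f_{S_j} takes values in pℤ, the form (1/p)·f_{S_j}|N is ℤ-equivalent to some T_i; (ii) for every i and every subgroup M ≤ ℤ³ with ℤ³/M ≅ ℤ/pℤ ⊕ ℤ/pℤ on which f_{T_i} takes values in pℤ, the Gram matrix of f_{T_i}|M is ℤ-equivalent to p·Gram(S_j) for some j. Set 𝓜 := (r(T_i^p, S_j)/o(T_i)) and 𝓝 := (r(T_i^p, S_j)/o(S_j)), u×v matrices over ℚ, and assume rank(𝓜) = u. Then the u×u matrix 𝓜𝓝ᵗ is invertible, and for every positive integer n: p·w = 𝓜·a − (𝓜𝓝ᵗ)^{-1}·𝓜·(b + a), where a := (r(n,S_j)/o(S_j))_{j=1}^{v},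 b := (r(p²n, S_j)/o(S_j))_{j=1}^{v}, and w := (#{x ∈ ℤ³ : p·f_{T_i}(x) = n}/o(T_i))_{i=1}^{u} (so the i-th entry of w is r(n, T_i^p)/o(T_i)). -/

import Mathlib

open Matrix

noncomputable section

/-- The image of an integral matrix in the rational matrices. -/
def intMap (X : Matrix (Fin 3) (Fin 3) ℤ) : Matrix (Fin 3) (Fin 3) ℚ :=
  X.map fun a => (a : ℚ)

/-- The value of the quadratic form with Gram matrix `A` at an integral vector `x`. -/
def qf (A : Matrix (Fin 3) (Fin 3) ℚ) (x : Fin 3 → ℤ) : ℚ :=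
  (fun i => (x i : ℚ)) ⬝ᵥ A.mulVec fun i => (x i : ℚ)

/-- A rational symmetric matrix is half-integral: integral diagonal, off-diagonal in (1/2)ℤ. -/
def HalfIntegral (A : Matrix (Fin 3) (Fin 3) ℚ) : Prop :=
  (∀ i, ∃ n : ℤ, A i i = n) ∧ ∀ i j, ∃ n : ℤ, 2 * A i j = n

/-- `A` is symmetric and positive definite. -/
def PosDef3 (A : Matrix (Fin 3) (Fin 3) ℚ) : Prop :=
  A.IsSymm ∧ ∀ x : Fin 3 → ℚ, x ≠ 0 → 0 < x ⬝ᵥ A.mulVec x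

/-- `r(K, L)`: the number of representations of the form with Gram matrix `A` by the form
with Gram matrix `B`. -/
def repNum (A B : Matrix (Fin 3) (Fin 3) ℚ) : ℕ :=
  Nat.card {X : Matrix (Fin 3) (Fin 3) ℤ // (intMap X)ᵀ * B * intMap X = A}

/-- `o(L)`: the number of integral automorphs of the form with Gram matrix `A`. -/
def autNum (A : Matrix (Fin 3) (Fin 3) ℚ) : ℕ :=
  Nat.card {X : Matrix (Fin 3) (Fin 3) ℤ // IsUnit X.det ∧ (intMap X)ᵀ * A * intMap X = A}

/-- `r(n, f)`: the number of representations of the integer `n` by the form with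
Gram matrix `A`. -/
def rEval (A : Matrix (Fin 3) (Fin 3) ℚ) (n : ℤ) : ℕ :=
  Nat.card {x : Fin 3 → ℤ // qf A x = (n : ℚ)}

/-- ℤ-equivalence of Gram matrices. -/
def ZEquiv (A B : Matrix (Fin 3) (Fin 3) ℚ) : Prop :=
  ∃ X : Matrix (Fin 3) (Fin 3) ℤ, IsUnit X.det ∧ (intMap X)ᵀ * A * intMap X = B

/-- The Watson set `Λ_p(A) = {x ∈ ℤ³ : f_A(x + z) ≡ f_A(z) (mod p) for all z ∈ ℤ³}`. -/
def LamSet (p : ℕ) (A : Matrix (Fin 3) (Fin 3) ℚ) : Set (Fin 3 → ℤ) :=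
  {x | ∀ z : Fin 3 → ℤ, ∃ k : ℤ, qf A (x + z) - qf A z = (p : ℚ) * k}

/-- ℤ_q-equivalence of rational Gram matrices (inside ℚ_q). -/
def ZqEquiv (q : ℕ) [Fact q.Prime] (A B : Matrix (Fin 3) (Fin 3) ℚ) : Prop :=
  ∃ X : Matrix (Fin 3) (Fin 3) ℤ_[q], IsUnit X.det ∧
    (X.map fun a => (a : ℚ_[q]))ᵀ * A.map (fun a => (a : ℚ_[q])) * X.map (fun a => (a : ℚ_[q]))
      = B.map fun a => (a : ℚ_[q])

/-- ℤ_q-equivalence of a rational Gram matrix to a q-adic target matrix. -/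
def ZpEquivTo (q : ℕ) [Fact q.Prime] (A : Matrix (Fin 3) (Fin 3) ℚ)
    (B : Matrix (Fin 3) (Fin 3) ℚ_[q]) : Prop :=
  ∃ X : Matrix (Fin 3) (Fin 3) ℤ_[q], IsUnit X.det ∧
    (X.map fun a => (a : ℚ_[q]))ᵀ * A.map (fun a => (a : ℚ_[q])) * X.map (fun a => (a : ℚ_[q])) = B

/-- The block diagonal matrix `H ⊕ [c]` with `H = [[0,1/2],[1/2,0]]`. -/
def Hblock (q : ℕ) [Fact q.Prime] (c : ℚ_[q]) : Matrix (Fin 3) (Fin 3) ℚ_[q] :=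
  !![0, 1/2, 0; 1/2, 0, 0; 0, 0, c]

theorem intMap_mul (X Y : Matrix (Fin 3) (Fin 3) ℤ) : intMap (X * Y) = intMap X * intMap Y :=
  Matrix.map_mul (f := Int.castRingHom ℚ)

theorem intMap_one : intMap 1 = 1 := by
  simp [intMap]

theorem det_intMap (X : Matrix (Fin 3) (Fin 3) ℤ) : (intMap X).det = (X.det : ℚ) :=
  ((Int.castRingHom ℚ).map_det X).symm

theorem intMap_mulVec (X : Matrix (Fin 3) (Fin 3) ℤ) (y : Fin 3 → ℤ) :
    (fun i => ((X *ᵥ y) i : ℚ)) = intMap X *ᵥ fun i => (y i : ℚ) := by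
  ext i
  simp [Matrix.mulVec, dotProduct, intMap]

theorem qf_mulVec (A : Matrix (Fin 3) (Fin 3) ℚ) (X : Matrix (Fin 3) (Fin 3) ℤ) (y : Fin 3 → ℤ) :
    qf A (X *ᵥ y) = qf ((intMap X)ᵀ * A * intMap X) y := by
  unfold qf
  rw [intMap_mulVec, ← Matrix.mulVec_mulVec, ← Matrix.mulVec_mulVec,
    Matrix.dotProduct_mulVec _ (intMap X)ᵀ, Matrix.vecMul_transpose]

theorem qf_smul (c : ℚ) (A : Matrix (Fin 3) (Fin 3) ℚ) (x : Fin 3 → ℤ) :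
    qf (c • A) x = c * qf A x := by
  simp [qf, Matrix.smul_mulVec]

theorem gram_mul (A : Matrix (Fin 3) (Fin 3) ℚ) (X Y : Matrix (Fin 3) (Fin 3) ℤ) :
    (intMap (X * Y))ᵀ * A * intMap (X * Y) =
      (intMap Y)ᵀ * ((intMap X)ᵀ * A * intMap X) * intMap Y := by
  simp only [intMap_mul, Matrix.transpose_mul, Matrix.mul_assoc]

theorem gram_smul (c : ℚ) (A Z : Matrix (Fin 3) (Fin 3) ℚ) :
    Zᵀ * (c • A) * Z = c • (Zᵀ * A * Z) := by
  simp

theorem autNum_smul {c : ℚ} (hc : c ≠ 0) (A : Matrix (Fin 3) (Fin 3) ℚ) :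
    autNum (c • A) = autNum A := by
  unfold autNum
  simp only [gram_smul, (smul_right_injective _ hc).eq_iff]

theorem ZEquiv.of_smul {c : ℚ} (hc : c ≠ 0) {A B : Matrix (Fin 3) (Fin 3) ℚ}
    (h : ZEquiv (c • A) (c • B)) : ZEquiv A B := by
  obtain ⟨X, hX, h⟩ := h
  rw [gram_smul] at h
  exact ⟨X, hX, smul_right_injective _ hc h⟩

namespace PosDef3

variable {A : Matrix (Fin 3) (Fin 3) ℚ}

theorem smul (hA : PosDef3 A) {c : ℚ} (hc : 0 < c) : PosDef3 (c • A) := by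
  refine ⟨?_, fun x hx => ?_⟩
  · unfold Matrix.IsSymm
    rw [Matrix.transpose_smul, hA.1.eq]
  · rw [Matrix.smul_mulVec, dotProduct_smul]
    exact mul_pos hc (hA.2 x hx)

theorem nonneg (hA : PosDef3 A) (x : Fin 3 → ℚ) : 0 ≤ x ⬝ᵥ A *ᵥ x := by
  by_cases hx : x = 0
  · simp [hx]
  · exact (hA.2 x hx).le

theorem det_ne_zero (hA : PosDef3 A) : A.det ≠ 0 := by
  intro h
  obtain ⟨v, hv, h⟩ := Matrix.exists_mulVec_eq_zero_iff.mpr h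
  have := hA.2 v hv
  simp [h] at this

theorem dotProduct_sq_le (hA : PosDef3 A) (x y : Fin 3 → ℚ) :
    (x ⬝ᵥ A *ᵥ y) ^ 2 ≤ (x ⬝ᵥ A *ᵥ x) * (y ⬝ᵥ A *ᵥ y) := by
  by_cases hy : y = 0
  · simp [hy]
  have hpos := hA.2 y hy
  have hsymm : y ⬝ᵥ A *ᵥ x = x ⬝ᵥ A *ᵥ y := by
    rw [Matrix.dotProduct_mulVec, ← Matrix.mulVec_transpose, hA.1.eq, dotProduct_comm]
  have h := hA.nonneg ((y ⬝ᵥ A *ᵥ y) • x - (x ⬝ᵥ A *ᵥ y) • y)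
  simp only [Matrix.mulVec_sub, Matrix.mulVec_smul, sub_dotProduct, dotProduct_sub,
    smul_dotProduct, dotProduct_smul, smul_eq_mul, hsymm] at h
  have h2 : 0 ≤ (y ⬝ᵥ A *ᵥ y) * ((x ⬝ᵥ A *ᵥ x) * (y ⬝ᵥ A *ᵥ y) - (x ⬝ᵥ A *ᵥ y) ^ 2) := by
    linarith
  have := nonneg_of_mul_nonneg_right h2 hpos
  linarith

theorem exists_sq_le (hA : PosDef3 A) (i : Fin 3) :
    ∃ C : ℚ, ∀ x : Fin 3 → ℤ, (x i : ℚ) ^ 2 ≤ C * qf A x := by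
  have hu : IsUnit A.det := hA.det_ne_zero.isUnit
  refine ⟨(A⁻¹ *ᵥ Pi.single i 1) ⬝ᵥ A *ᵥ (A⁻¹ *ᵥ Pi.single i 1), fun x => ?_⟩
  have h := hA.dotProduct_sq_le (fun i => (x i : ℚ)) (A⁻¹ *ᵥ Pi.single i 1)
  rw [mul_comm] at h
  have hAi : A *ᵥ (A⁻¹ *ᵥ Pi.single i 1) = Pi.single i 1 := by
    rw [Matrix.mulVec_mulVec, Matrix.mul_nonsing_inv _ hu, Matrix.one_mulVec]
  rw [hAi, dotProduct_single_one] at h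
  rw [hAi]
  exact h

theorem finite_rep (hA : PosDef3 A) (c : ℚ) : Finite {x : Fin 3 → ℤ // qf A x = c} := by
  choose C hC using hA.exists_sq_le
  obtain ⟨m, hm⟩ : ∃ m : ℕ, ∀ i, C i * c ≤ m := by
    refine ⟨⌈|C 0 * c| + |C 1 * c| + |C 2 * c|⌉₊, fun i => ?_⟩
    refine le_trans ?_ (Nat.le_ceil _)
    have := le_abs_self (C i * c)
    have := abs_nonneg (C 0 * c)
    have := abs_nonneg (C 1 * c)
    have := abs_nonneg (C 2 * c)
    fin_cases i <;> simp only at * <;> linarith!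
  refine Set.Finite.subset (Set.Finite.pi' fun _ : Fin 3 => Set.finite_Icc (-(m : ℤ)) m) ?_
  intro x hx i
  have h1 := (hC i x).trans ((show qf A x = c from hx) ▸ hm i)
  have h2 : x i ^ 2 ≤ (m : ℤ) := by exact_mod_cast h1
  constructor <;> nlinarith

theorem finite_rep_form (hA : PosDef3 A) (B : Matrix (Fin 3) (Fin 3) ℚ) :
    Finite {X : Matrix (Fin 3) (Fin 3) ℤ // (intMap X)ᵀ * A * intMap X = B} := by
  have := fun c => hA.finite_rep c
  let F : {X : Matrix (Fin 3) (Fin 3) ℤ // (intMap X)ᵀ * A * intMap X = B} →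
      ∀ j : Fin 3, {x : Fin 3 → ℤ // qf A x = qf B (Pi.single j 1)} :=
    fun X j => ⟨X.1 *ᵥ Pi.single j 1, by rw [qf_mulVec, X.2]⟩
  refine Finite.of_injective F fun X Y h => Subtype.ext ?_
  ext i j
  have := congrFun (congrArg Subtype.val (congrFun h j)) i
  simpa [F] using this

theorem autNum_pos (hA : PosDef3 A) : 0 < autNum A := by
  have := hA.finite_rep_form A
  have : Finite {X : Matrix (Fin 3) (Fin 3) ℤ //
      IsUnit X.det ∧ (intMap X)ᵀ * A * intMap X = A} :=
    Finite.of_injective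
      (fun X => (⟨X.1, X.2.2⟩ :
        {X : Matrix (Fin 3) (Fin 3) ℤ // (intMap X)ᵀ * A * intMap X = A}))
      fun X Y h => Subtype.ext (congrArg (fun Z => Z.1) h)
  have : Nonempty {X : Matrix (Fin 3) (Fin 3) ℤ //
      IsUnit X.det ∧ (intMap X)ᵀ * A * intMap X = A} :=
    ⟨⟨1, by simp, by simp [intMap_one]⟩⟩
  exact Nat.card_pos

theorem det_ne_zero_of_gram {B : Matrix (Fin 3) (Fin 3) ℚ} (hB : PosDef3 B)
    {X : Matrix (Fin 3) (Fin 3) ℤ} (h : (intMap X)ᵀ * A * intMap X = B) : X.det ≠ 0 := by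
  intro h0
  apply hB.det_ne_zero
  rw [← h, Matrix.det_mul, det_intMap, h0]
  simp

end PosDef3

/-- The sublattice of `ℤ³` spanned by the columns of `X`. -/
def colLattice (X : Matrix (Fin 3) (Fin 3) ℤ) : AddSubgroup (Fin 3 → ℤ) :=
  X.mulVecLin.toAddMonoidHom.range

theorem mem_colLattice {X : Matrix (Fin 3) (Fin 3) ℤ} {x : Fin 3 → ℤ} :
    x ∈ colLattice X ↔ ∃ c, x = X *ᵥ c := by
  simp [colLattice, eq_comm]

theorem index_colLattice {X : Matrix (Fin 3) (Fin 3) ℤ} (hX : X.det ≠ 0) :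
    (colLattice X).index = X.det.natAbs := by
  let b := (Pi.basisFun ℤ (Fin 3)).map
    (LinearEquiv.ofInjective X.mulVecLin (Matrix.mulVec_injective_of_det_ne_zero hX))
  have h := AddSubgroup.index_eq_natAbs_det (Pi.basisFun ℤ (Fin 3)) (colLattice X) b
  rw [h, Pi.basisFun_det_apply]
  have : (Matrix.of fun i => ((b i : colLattice X) : Fin 3 → ℤ)) = Xᵀ := by
    ext i j
    have hb : ((b i : colLattice X) : Fin 3 → ℤ) = X *ᵥ Pi.single i 1 := by
      simp only [b, Module.Basis.map_apply, Pi.basisFun_apply]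
      rfl
    rw [Matrix.of_apply, hb]
    simp
  rw [← Matrix.det_transpose X, ← this]
  rfl

theorem exists_colLattice_eq (N : AddSubgroup (Fin 3 → ℤ)) (hN : N.index ≠ 0) :
    ∃ Y, colLattice Y = N := by
  have : N.FiniteIndex := ⟨hN⟩
  have hr : Module.finrank ℤ N.toIntSubmodule = 3 := by
    exact (AddSubgroup.finrank_eq_of_finiteIndex N).trans (by simp)
  let b : Module.Basis (Fin 3) ℤ N.toIntSubmodule := Module.finBasisOfFinrankEq ℤ _ hr
  refine ⟨Matrix.of fun i j => (b j : Fin 3 → ℤ) i, ?_⟩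
  have hb : ∀ c : Fin 3 → ℤ, (Matrix.of fun i j => (b j : Fin 3 → ℤ) i) *ᵥ c =
      ((∑ j, c j • b j : N.toIntSubmodule) : Fin 3 → ℤ) := by
    intro c
    ext i
    simp [Matrix.mulVec, dotProduct, mul_comm]
  ext x
  rw [mem_colLattice]
  constructor
  · rintro ⟨c, rfl⟩
    rw [hb]
    exact (∑ j, c j • b j : N.toIntSubmodule).2
  · intro hx
    refine ⟨b.repr ⟨x, hx⟩, ?_⟩
    rw [hb, b.sum_repr]

theorem colLattice_mul_of_isUnit (X : Matrix (Fin 3) (Fin 3) ℤ) {U : Matrix (Fin 3) (Fin 3) ℤ}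
    (hU : IsUnit U.det) : colLattice (X * U) = colLattice X := by
  ext x
  simp only [mem_colLattice]
  constructor
  · rintro ⟨c, rfl⟩
    exact ⟨U *ᵥ c, by rw [Matrix.mulVec_mulVec]⟩
  · rintro ⟨c, rfl⟩
    refine ⟨U⁻¹ *ᵥ c, ?_⟩
    rw [Matrix.mulVec_mulVec, Matrix.mul_assoc, Matrix.mul_nonsing_inv _ hU, Matrix.mul_one]

theorem exists_mul_of_colLattice_le {X Y : Matrix (Fin 3) (Fin 3) ℤ}
    (h : colLattice Y ≤ colLattice X) : ∃ U, Y = X * U := by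
  have : ∀ j, ∃ c, Y *ᵥ Pi.single j 1 = X *ᵥ c := fun j =>
    mem_colLattice.mp (h (mem_colLattice.mpr ⟨_, rfl⟩))
  choose c hc using this
  refine ⟨Matrix.of fun i j => c j i, ?_⟩
  ext i j
  have := congrFun (hc j) i
  rw [Matrix.mulVec_single_one] at this
  simpa [Matrix.mul_apply, Matrix.mulVec, dotProduct] using this

theorem exists_unit_of_colLattice_eq {X Y : Matrix (Fin 3) (Fin 3) ℤ} (hX : X.det ≠ 0)
    (h : colLattice Y = colLattice X) : ∃ U, IsUnit U.det ∧ Y = X * U := by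
  obtain ⟨U, hU⟩ := exists_mul_of_colLattice_le h.le
  obtain ⟨V, hV⟩ := exists_mul_of_colLattice_le h.ge
  refine ⟨U, ?_, hU⟩
  have h1 : X.det * (U.det * V.det - 1) = 0 := by
    have := congrArg Matrix.det hV
    rw [hU, Matrix.det_mul, Matrix.det_mul] at this
    linear_combination -this
  have h2 := (mul_eq_zero.mp h1).resolve_left hX
  exact IsUnit.of_mul_eq_one V.det (by linarith)

/-- The number of isometric embeddings with a prescribed image is zero or the number of
automorphs. -/
theorem card_gram_colLattice {A B : Matrix (Fin 3) (Fin 3) ℚ} (hB : PosDef3 B)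
    {X : Matrix (Fin 3) (Fin 3) ℤ} (hX : (intMap X)ᵀ * A * intMap X = B) :
    Nat.card {Y : {Y : Matrix (Fin 3) (Fin 3) ℤ // (intMap Y)ᵀ * A * intMap Y = B} //
      colLattice Y.1 = colLattice X} = autNum B := by
  have hdet := hB.det_ne_zero_of_gram hX
  symm
  refine Nat.card_congr (Equiv.ofBijective (fun U => ⟨⟨X * U.1, ?_⟩, ?_⟩) ⟨?_, ?_⟩)
  · rw [gram_mul, hX, U.2.2]
  · exact colLattice_mul_of_isUnit X U.2.1
  · intro U V h
    have h1 : X * U.1 = X * V.1 := congrArg (fun Z => Z.1.1) h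
    ext1
    refine Matrix.mulVec_injective (funext fun w =>
      Matrix.mulVec_injective_of_det_ne_zero hdet ?_)
    rw [Matrix.mulVec_mulVec, Matrix.mulVec_mulVec, h1]
  · rintro ⟨⟨Y, hY⟩, hYX⟩
    obtain ⟨U, hU, rfl⟩ := exists_unit_of_colLattice_eq hdet hYX
    refine ⟨⟨U, hU, ?_⟩, rfl⟩
    rw [← hX, ← gram_mul, hY, hX]

theorem card_rep_mem_colLattice {A B : Matrix (Fin 3) (Fin 3) ℚ} (hB : PosDef3 B)
    {X : Matrix (Fin 3) (Fin 3) ℤ} (hX : (intMap X)ᵀ * A * intMap X = B) (c : ℚ) :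
    Nat.card {y : Fin 3 → ℤ // qf B y = c} =
      Nat.card {x : {x : Fin 3 → ℤ // qf A x = c} // x.1 ∈ colLattice X} := by
  refine Nat.card_congr (Equiv.ofBijective
    (fun y => ⟨⟨X *ᵥ y.1, ?_⟩, mem_colLattice.mpr ⟨_, rfl⟩⟩) ⟨?_, ?_⟩)
  · rw [qf_mulVec, hX, y.2]
  · intro y z h
    exact Subtype.ext (Matrix.mulVec_injective_of_det_ne_zero (hB.det_ne_zero_of_gram hX)
      (congrArg (fun w => w.1.1) h))
  · rintro ⟨⟨x, hx⟩, hm⟩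
    obtain ⟨y, rfl⟩ := mem_colLattice.mp hm
    exact ⟨⟨y, by rw [← hX, ← qf_mulVec, hx]⟩, rfl⟩

/-- Counting vectors through isometric embeddings: if the sublattices `N k` are exactly the images
of the embeddings of the inequivalent forms `B i` into `A`, then the weighted number of
representations by the `B i` counts the vectors of `A` with their multiplicity in the `N k`. -/
theorem sum_repNum_mul_card {ι κ : Type*} [Fintype ι] [Fintype κ]
    {A : Matrix (Fin 3) (Fin 3) ℚ} (hA : PosDef3 A) {B : ι → Matrix (Fin 3) (Fin 3) ℚ}
    (hB : ∀ i, PosDef3 (B i)) (hne : ∀ i j, i ≠ j → ¬ ZEquiv (B i) (B j))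
    (N : κ → AddSubgroup (Fin 3 → ℤ)) (hN : Function.Injective N)
    (h1 : ∀ i X, (intMap X)ᵀ * A * intMap X = B i → ∃ k, colLattice X = N k)
    (h2 : ∀ k, ∃ i X, (intMap X)ᵀ * A * intMap X = B i ∧ colLattice X = N k)
    (c : ℚ) (μ : {x : Fin 3 → ℤ // qf A x = c} → ℕ)
    (hμ : ∀ x, Nat.card {k // x.1 ∈ N k} = μ x) :
    ∑ i, (repNum (B i) A : ℚ) / (autNum (B i) : ℚ) *
      (Nat.card {y : Fin 3 → ℤ // qf (B i) y = c} : ℚ) = ∑ᶠ x, (μ x : ℚ) := by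
  classical
  have := hA.finite_rep c
  have : Fintype {x : Fin 3 → ℤ // qf A x = c} := Fintype.ofFinite _
  choose g G hG hGN using h2
  have key : ∀ i k X, (intMap X)ᵀ * A * intMap X = B i → colLattice X = N k → g k = i := by
    intro i k X hX hXN
    by_contra hgi
    refine hne _ _ hgi ?_
    obtain ⟨U, hU, rfl⟩ := exists_unit_of_colLattice_eq
      ((hB _).det_ne_zero_of_gram (hG k)) (hXN.trans (hGN k).symm)
    exact ⟨U, hU, by rw [← hG k, ← gram_mul, hX]⟩
  have hrep : ∀ i, repNum (B i) A = ∑ k, if g k = i then autNum (B i) else 0 := by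
    intro i
    have := hA.finite_rep_form (B i)
    have : ∀ k, Finite {Y : {Y : Matrix (Fin 3) (Fin 3) ℤ // (intMap Y)ᵀ * A * intMap Y = B i} //
      colLattice Y.1 = N k} := fun k => inferInstance
    choose f hf using h1 i
    unfold repNum
    rw [Nat.card_congr (Equiv.sigmaFiberEquiv
      fun Y : {Y : Matrix (Fin 3) (Fin 3) ℤ // (intMap Y)ᵀ * A * intMap Y = B i} =>
        f Y.1 Y.2).symm, Nat.card_sigma]
    refine Finset.sum_congr rfl fun k _ => ?_
    have hfk : ∀ Y : {Y : Matrix (Fin 3) (Fin 3) ℤ // (intMap Y)ᵀ * A * intMap Y = B i},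
        f Y.1 Y.2 = k ↔ colLattice Y.1 = N k :=
      fun Y => by rw [hf Y.1 Y.2, hN.eq_iff]
    rw [Nat.card_congr (Equiv.subtypeEquivRight hfk)]
    split_ifs with h
    · subst h
      rw [← hGN k]
      exact card_gram_colLattice (hB _) (hG k)
    · refine Nat.card_eq_zero.mpr (Or.inl ⟨fun Y => h (key i k _ Y.1.2 Y.2)⟩)
  have hterm : ∀ i, (repNum (B i) A : ℚ) / (autNum (B i) : ℚ) *
      (Nat.card {y : Fin 3 → ℤ // qf (B i) y = c} : ℚ) =
      ∑ k, if g k = i then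
        (Nat.card {x : {x : Fin 3 → ℤ // qf A x = c} // x.1 ∈ N k} : ℚ) else 0 := by
    intro i
    have h0 : (autNum (B i) : ℚ) ≠ 0 := by exact_mod_cast (hB i).autNum_pos.ne'
    rw [hrep, Nat.cast_sum, Finset.sum_div, Finset.sum_mul]
    refine Finset.sum_congr rfl fun k _ => ?_
    split_ifs with h
    · subst h
      rw [div_self h0, one_mul, card_rep_mem_colLattice (hB _) (hG k), hGN]
    · simp
  simp_rw [hterm]
  rw [Finset.sum_comm, finsum_eq_sum_of_fintype]
  simp only [Finset.sum_ite_eq, Finset.mem_univ, if_true]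
  simp_rw [← hμ]
  simp only [Nat.card_eq_fintype_card, Fintype.card_subtype, ← Nat.cast_sum]
  congr 1
  exact (Finset.sum_card_bipartiteAbove_eq_sum_card_bipartiteBelow
    (fun (x : {x : Fin 3 → ℤ // qf A x = c}) k => x.1 ∈ N k)).symm

theorem abs_eq_abs_of_padicNorm_eq {a b : ℚ} (hb : b ≠ 0)
    (h : ∀ q : ℕ, q.Prime → padicNorm q a = padicNorm q b) : |a| = |b| := by
  have hdvd : ∀ q : ℕ, q.Prime → (q ∣ (a / b).num.natAbs ↔ q ∣ (a / b).den) := by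
    intro q hq
    have : Fact q.Prime := ⟨hq⟩
    have h1 : padicNorm q ((a / b).num : ℚ) = padicNorm q ((a / b).den : ℚ) := by
      have h2 : ((a / b).num : ℚ) * b = (a / b).den * a := by
        have := Rat.num_div_den (a / b)
        have hd : ((a / b).den : ℚ) ≠ 0 := by exact_mod_cast (a / b).den_ne_zero
        field_simp at this
        linarith
      have h3 := congrArg (padicNorm q) h2
      rw [padicNorm.mul, padicNorm.mul, h q hq] at h3
      exact mul_right_cancel₀ (padicNorm.nonzero hb) h3
    rw [← Int.natCast_dvd, ← padicNorm.int_lt_one_iff, h1, padicNorm.nat_lt_one_iff]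
  have hcop := (a / b).reduced
  have hnum : (a / b).num.natAbs = 1 := by
    by_contra hne
    obtain ⟨q, hq, hd⟩ := Nat.exists_prime_and_dvd hne
    exact Nat.not_coprime_of_dvd_of_dvd hq.one_lt hd ((hdvd q hq).mp hd) hcop
  have hden : (a / b).den = 1 := by
    by_contra hne
    obtain ⟨q, hq, hd⟩ := Nat.exists_prime_and_dvd hne
    exact Nat.not_coprime_of_dvd_of_dvd hq.one_lt ((hdvd q hq).mpr hd) hd hcop
  have h1 : |a / b| = 1 := by
    rw [← Rat.num_div_den (a / b), hden, Nat.cast_one, div_one, ← Int.cast_abs,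
      Int.abs_eq_natAbs, hnum]
    simp
  rwa [abs_div, div_eq_one_iff_eq (abs_ne_zero.mpr hb)] at h1

section Local

variable {q : ℕ} [Fact q.Prime]

theorem norm_det_gram {X : Matrix (Fin 3) (Fin 3) ℤ_[q]} (hX : IsUnit X.det)
    (M : Matrix (Fin 3) (Fin 3) ℚ_[q]) :
    ‖((X.map fun a => (a : ℚ_[q]))ᵀ * M * X.map fun a => (a : ℚ_[q])).det‖ = ‖M.det‖ := by
  have h : (X.map fun a => (a : ℚ_[q])).det = (X.det : ℚ_[q]) :=
    (PadicInt.Coe.ringHom.map_det X).symm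
  have h1 : ‖((X.det : ℤ_[q]) : ℚ_[q])‖ = 1 := PadicInt.isUnit_iff.mp hX
  rw [Matrix.det_mul, Matrix.det_mul, Matrix.det_transpose, h, norm_mul, norm_mul, h1]
  simp

theorem det_map_ratCast (A : Matrix (Fin 3) (Fin 3) ℚ) :
    (A.map fun a => (a : ℚ_[q])).det = (A.det : ℚ_[q]) :=
  ((Rat.castHom ℚ_[q]).map_det A).symm

theorem ZqEquiv.padicNorm_det {A B : Matrix (Fin 3) (Fin 3) ℚ} (h : ZqEquiv q A B) :
    padicNorm q A.det = padicNorm q B.det := by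
  obtain ⟨X, hX, h⟩ := h
  have h1 := norm_det_gram hX (A.map fun a => (a : ℚ_[q]))
  rw [h, det_map_ratCast, det_map_ratCast, Padic.eq_padicNorm, Padic.eq_padicNorm] at h1
  exact_mod_cast h1.symm

theorem det_Hblock (c : ℚ_[q]) : (Hblock q c).det = -c * (1 / 2) ^ 2 := by
  simp [Hblock, Matrix.det_fin_three]
  ring

theorem ZpEquivTo.norm_det {A : Matrix (Fin 3) (Fin 3) ℚ} {c : ℚ_[q]}
    (h : ZpEquivTo q A (Hblock q c)) : (padicNorm q A.det : ℝ) = ‖c‖ * ‖(1 / 2 : ℚ_[q])‖ ^ 2 := by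
  obtain ⟨X, hX, h⟩ := h
  have h1 := norm_det_gram hX (A.map fun a => (a : ℚ_[q]))
  rw [h, det_map_ratCast, det_Hblock, Padic.eq_padicNorm, norm_mul, norm_neg, norm_pow] at h1
  exact h1.symm

/-- Coordinates over `ℤ_p` splitting a form that is locally `H ⊕ [c]`. -/
theorem ZpEquivTo.exists_coords {A : Matrix (Fin 3) (Fin 3) ℚ} {c : ℤ_[q]}
    (h : ZpEquivTo q A (Hblock q c)) :
    ∃ y : (Fin 3 → ℤ) →+ (Fin 3 → ℤ_[q]),
      (∀ x, (qf A x : ℚ_[q]) = ((y x 0 * y x 1 + c * y x 2 ^ 2 : ℤ_[q]) : ℚ_[q])) ∧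
      (∀ w : Fin 3 → ZMod q, ∃ x, ∀ i, PadicInt.toZMod (y x i) = w i) ∧
      ∀ x, (∀ i, PadicInt.toZMod (y x i) = 0) → ∃ x', x = (q : ℤ) • x' := by
  obtain ⟨X, hX, h⟩ := h
  let y : (Fin 3 → ℤ) →+ (Fin 3 → ℤ_[q]) :=
    { toFun := fun x => X⁻¹ *ᵥ fun i => (x i : ℤ_[q])
      map_zero' := by
        ext i
        simp [Matrix.mulVec, dotProduct]
      map_add' := fun a b => by
        rw [← Matrix.mulVec_add]
        congr 1
        ext i
        simp }
  have hy : ∀ x, y x = X⁻¹ *ᵥ fun i => (x i : ℤ_[q]) := fun _ => rfl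
  have hXy : ∀ x, X *ᵥ y x = fun i => (x i : ℤ_[q]) := fun x => by
    rw [hy, Matrix.mulVec_mulVec, Matrix.mul_nonsing_inv _ hX, Matrix.one_mulVec]
  have hmod : ∀ (Z : Matrix (Fin 3) (Fin 3) ℤ_[q]) (v : Fin 3 → ℤ_[q]),
      (fun i => PadicInt.toZMod ((Z *ᵥ v) i)) =
        Z.map PadicInt.toZMod *ᵥ fun i => PadicInt.toZMod (v i) := by
    intro Z v
    ext i
    simp [Matrix.mulVec, dotProduct]
  refine ⟨y, fun x => ?_, fun w => ?_, fun x hx => ?_⟩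
  · have h1 : (fun i => ((x i : ℚ) : ℚ_[q])) =
        (X.map fun a => (a : ℚ_[q])) *ᵥ fun i => (y x i : ℚ_[q]) := by
      ext i
      have := congrArg (fun z : ℤ_[q] => (z : ℚ_[q])) (congrFun (hXy x) i)
      simp only [Matrix.mulVec, dotProduct, PadicInt.coe_sum, PadicInt.coe_mul] at this
      simp [Matrix.mulVec, dotProduct, this]
    have h2 : (qf A x : ℚ_[q]) = (fun i => ((x i : ℚ) : ℚ_[q])) ⬝ᵥ
        (A.map fun a => (a : ℚ_[q])) *ᵥ fun i => ((x i : ℚ) : ℚ_[q]) := by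
      simp [qf, Matrix.mulVec, dotProduct]
    rw [h2, h1, Matrix.mulVec_mulVec, ← Matrix.vecMul_transpose, ← Matrix.dotProduct_mulVec,
      Matrix.mulVec_mulVec, ← Matrix.mul_assoc, h]
    simp [Hblock, Matrix.mulVec, dotProduct, Fin.sum_univ_three]
    ring
  · let v : Fin 3 → ZMod q := X.map PadicInt.toZMod *ᵥ w
    refine ⟨fun i => ((v i).val : ℤ), fun i => ?_⟩
    refine congrFun (a := i) (f := fun i => PadicInt.toZMod (y _ i)) ?_
    have hv : (fun i => PadicInt.toZMod ((((v i).val : ℤ) : ℤ_[q]))) = v := by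
      ext i
      simp
    rw [hy, hmod, hv, Matrix.mulVec_mulVec, ← Matrix.map_mul, Matrix.nonsing_inv_mul _ hX]
    simp
  · have h1 := hmod X (y x)
    rw [hXy, funext hx] at h1
    have h2 : ∀ i, (q : ℤ) ∣ x i := by
      intro i
      have := congrFun h1 i
      rw [← ZMod.intCast_zmod_eq_zero_iff_dvd]
      simpa [Matrix.mulVec, dotProduct] using this
    choose z hz using h2
    exact ⟨z, by ext i; simp [hz i]⟩

end Local

theorem HalfIntegral.exists_qf_eq {A : Matrix (Fin 3) (Fin 3) ℚ} (hs : A.IsSymm)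
    (h : HalfIntegral A) (x : Fin 3 → ℤ) : ∃ k : ℤ, qf A x = k := by
  choose d hd using h.1
  choose e he using h.2
  refine ⟨d 0 * x 0 ^ 2 + d 1 * x 1 ^ 2 + d 2 * x 2 ^ 2 + e 0 1 * (x 0 * x 1) +
    e 0 2 * (x 0 * x 2) + e 1 2 * (x 1 * x 2), ?_⟩
  push_cast
  simp only [← hd, ← he]
  have h1 := hs.apply 0 1
  have h2 := hs.apply 0 2
  have h3 := hs.apply 1 2
  simp only [qf, Matrix.mulVec, dotProduct, Fin.sum_univ_three, h1, h2, h3]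
  ring

theorem qf_intSMul (A : Matrix (Fin 3) (Fin 3) ℚ) (m : ℤ) (x : Fin 3 → ℤ) :
    qf A (m • x) = (m : ℚ) ^ 2 * qf A x := by
  simp only [qf, Matrix.mulVec, dotProduct, Fin.sum_univ_three, Pi.smul_apply, smul_eq_mul,
    Int.cast_mul]
  ring

theorem AddSubgroup.eq_of_le_of_index_eq {G : Type*} [AddGroup G] {H K : AddSubgroup G}
    (h : H ≤ K) (hi : H.index = K.index) (hK : K.index ≠ 0) : H = K := by
  refine le_antisymm h (AddSubgroup.relIndex_eq_one.mp ?_)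
  have := AddSubgroup.relIndex_mul_index h
  rw [hi] at this
  exact Nat.eq_of_mul_eq_mul_right (Nat.pos_of_ne_zero hK) (by rw [this, one_mul])

theorem index_ker_of_surjective {G G' : Type*} [AddGroup G] [AddGroup G'] (f : G →+ G')
    (hf : Function.Surjective f) : f.ker.index = Nat.card G' := by
  rw [AddSubgroup.index_ker, AddMonoidHom.range_eq_top.mpr hf]
  exact Nat.card_congr AddSubgroup.topEquiv.toEquiv

open Classical in
theorem finsum_ite_smul {A : Matrix (Fin 3) (Fin 3) ℚ} (hA : PosDef3 A) {p : ℕ} (hp : p ≠ 0)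
    {c c' : ℚ} (hc : c = (p : ℚ) ^ 2 * c') (m : ℕ) :
    ∑ᶠ x : {x : Fin 3 → ℤ // qf A x = c},
      ((if ∃ x', x.1 = (p : ℤ) • x' then 1 + m else 1 : ℕ) : ℚ) =
    (Nat.card {x : Fin 3 → ℤ // qf A x = c} : ℚ) +
      m * (Nat.card {x : Fin 3 → ℤ // qf A x = c'} : ℚ) := by
  have := hA.finite_rep c
  have : Fintype {x : Fin 3 → ℤ // qf A x = c} := Fintype.ofFinite _
  have hp' : (p : ℤ) ≠ 0 := by exact_mod_cast hp
  have hpq : (p : ℚ) ^ 2 ≠ 0 := by positivity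
  have hcard : Nat.card {x : Fin 3 → ℤ // qf A x = c'} =
      Nat.card {x : {x : Fin 3 → ℤ // qf A x = c} // ∃ x', x.1 = (p : ℤ) • x'} := by
    refine Nat.card_congr (Equiv.ofBijective
      (fun y => ⟨⟨(p : ℤ) • y.1, by rw [qf_intSMul, y.2, hc]; simp⟩, y.1, rfl⟩) ⟨?_, ?_⟩)
    · intro y z h
      exact Subtype.ext (smul_right_injective _ hp' (congrArg (fun w => w.1.1) h))
    · rintro ⟨⟨x, hx⟩, y, hy⟩
      simp only at hy
      subst hy
      refine ⟨⟨y, ?_⟩, rfl⟩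
      rw [qf_intSMul, hc, Int.cast_natCast] at hx
      exact mul_left_cancel₀ hpq hx
  rw [finsum_eq_sum_of_fintype, hcard, Nat.card_eq_fintype_card, Fintype.card_eq_sum_ones,
    Nat.card_eq_fintype_card (α := {x : {x : Fin 3 → ℤ // qf A x = c} //
      ∃ x', x.1 = (p : ℤ) • x'}),
    Fintype.card_subtype, Finset.card_filter, ← Nat.cast_sum, ← Nat.cast_mul, ← Nat.cast_add,
    Finset.mul_sum, ← Finset.sum_add_distrib]
  congr 1
  refine Finset.sum_congr rfl fun x _ => ?_
  split_ifs <;> simp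

theorem exists_mul_eq_smul_one_of_natAbs_det {p : ℕ} {X : Matrix (Fin 3) (Fin 3) ℤ}
    (h : X.det.natAbs = p) : ∃ Z, X * Z = (p : ℤ) • (1 : Matrix (Fin 3) (Fin 3) ℤ) := by
  rcases Int.natAbs_eq X.det with h1 | h1
  · exact ⟨X.adjugate, by rw [Matrix.mul_adjugate, h1, h]⟩
  · exact ⟨-X.adjugate, by rw [Matrix.mul_neg, Matrix.mul_adjugate, h1, h, neg_smul, neg_neg]⟩

section Reduction

variable {p : ℕ} [Fact p.Prime]

/-- Coordinates modulo `p` for a half-integral form that is locally `H ⊕ [c]`. -/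
theorem ZpEquivTo.exists_mod_coords {A : Matrix (Fin 3) (Fin 3) ℚ} (hs : A.IsSymm)
    (hA : HalfIntegral A) {c : ℤ_[p]} (h : ZpEquivTo p A (Hblock p c)) :
    ∃ φ : (Fin 3 → ℤ) →+ (Fin 3 → ZMod p), Function.Surjective φ ∧
      (∀ x, φ x = 0 ↔ ∃ x', x = (p : ℤ) • x') ∧
      (∀ x, (∃ k : ℤ, qf A x = (p : ℚ) * k) ↔
        φ x 0 * φ x 1 + PadicInt.toZMod c * φ x 2 ^ 2 = 0) ∧
      (∀ ε : ℤ_[p]ˣ, c = p * ε → ∀ x, (∃ k : ℤ, qf A x = (p : ℚ) ^ 2 * k) →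
        φ x 0 = 0 → φ x 1 = 0 → φ x 2 = 0) := by
  have hp0 : (p : ℤ_[p]) ≠ 0 := by exact_mod_cast (Fact.out : p.Prime).ne_zero
  obtain ⟨y, hy, hsurj, hker⟩ := h.exists_coords
  have hval : ∀ x (k : ℤ), qf A x = k → (k : ℤ_[p]) = y x 0 * y x 1 + c * y x 2 ^ 2 := by
    intro x k hk
    have := hy x
    rw [hk, Rat.cast_intCast, ← PadicInt.coe_intCast] at this
    exact PadicInt.ext this
  have hdvd : ∀ z : ℤ_[p], PadicInt.toZMod z = 0 ↔ (p : ℤ_[p]) ∣ z := by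
    intro z
    rw [← RingHom.mem_ker, PadicInt.ker_toZMod, PadicInt.maximalIdeal_eq_span_p,
      Ideal.mem_span_singleton]
  let φ : (Fin 3 → ℤ) →+ (Fin 3 → ZMod p) :=
    { toFun := fun x i => PadicInt.toZMod (y x i)
      map_zero' := by ext i; simp
      map_add' := fun a b => by ext i; simp }
  have hφ : ∀ x i, φ x i = PadicInt.toZMod (y x i) := fun _ _ => rfl
  refine ⟨φ, fun w => ?_, fun x => ⟨fun hx => ?_, ?_⟩, fun x => ?_, fun ε hc x hx h0 h1 => ?_⟩
  · obtain ⟨x, hx⟩ := hsurj w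
    exact ⟨x, funext hx⟩
  · exact hker x fun i => congrFun hx i
  · rintro ⟨x', rfl⟩
    ext i
    rw [map_zsmul]
    simp
  · obtain ⟨k, hk⟩ := hA.exists_qf_eq hs x
    have h1 : (∃ k : ℤ, qf A x = (p : ℚ) * k) ↔ (p : ℤ) ∣ k := by
      rw [hk]
      exact ⟨fun ⟨m, hm⟩ => ⟨m, by exact_mod_cast hm⟩, fun ⟨m, hm⟩ => ⟨m, by exact_mod_cast hm⟩⟩
    have h2 := congrArg PadicInt.toZMod (hval x k hk)
    rw [h1, ← ZMod.intCast_zmod_eq_zero_iff_dvd]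
    simp only [map_intCast, map_add, map_mul, map_pow] at h2
    rw [h2]
    simp only [hφ]
  · obtain ⟨k, hk⟩ := hx
    obtain ⟨a, ha⟩ := (hdvd _).mp h0
    obtain ⟨b, hb⟩ := (hdvd _).mp h1
    have h2 := hval x (p ^ 2 * k) (by push_cast; exact hk)
    rw [ha, hb, hc] at h2
    push_cast at h2
    have h3 : (p : ℤ_[p]) * (ε * y x 2 ^ 2) = p * (p * (k - a * b)) := by
      linear_combination -h2
    have h4 := mul_left_cancel₀ hp0 h3
    have h5 : PadicInt.toZMod (ε * y x 2 ^ 2 : ℤ_[p]) = 0 := (hdvd _).mpr ⟨_, h4⟩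
    rw [map_mul] at h5
    have h6 := (mul_eq_zero.mp h5).resolve_left (ε.isUnit.map PadicInt.toZMod).ne_zero
    rw [map_pow] at h6
    exact eq_zero_of_pow_eq_zero h6

/-- For a form locally equivalent to `H ⊕ [pε]`, exactly two sublattices of index `p` carry values
divisible by `p`. -/
theorem sum_rep_down {ι : Type*} [Fintype ι] {ε : ℤ_[p]ˣ} {A : Matrix (Fin 3) (Fin 3) ℚ}
    (hA : PosDef3 A) (hAi : HalfIntegral A)
    (hAp : ZpEquivTo p A (Hblock p ((p : ℚ_[p]) * ((ε : ℤ_[p]) : ℚ_[p]))))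
    {B : ι → Matrix (Fin 3) (Fin 3) ℚ} (hB : ∀ i, PosDef3 (B i))
    (hne : ∀ i j, i ≠ j → ¬ ZEquiv (B i) (B j))
    (hBv : ∀ i x, ∃ k : ℤ, qf (B i) x = (p : ℚ) * k)
    (hdet : ∀ i X, (intMap X)ᵀ * A * intMap X = B i → X.det.natAbs = p)
    (hdown : ∀ N : AddSubgroup (Fin 3 → ℤ), N.index = p →
      (∀ x ∈ N, ∃ k : ℤ, qf A x = (p : ℚ) * k) →
      ∃ i X, (intMap X)ᵀ * A * intMap X = B i ∧ colLattice X = N) (n : ℤ) :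
    ∑ i, (repNum (B i) A : ℚ) / (autNum (B i) : ℚ) *
      (Nat.card {y : Fin 3 → ℤ // qf (B i) y = (p : ℚ) ^ 2 * n} : ℚ) =
    (Nat.card {x : Fin 3 → ℤ // qf A x = (p : ℚ) ^ 2 * n} : ℚ) +
      (Nat.card {x : Fin 3 → ℤ // qf A x = n} : ℚ) := by
  classical
  have hp : p.Prime := Fact.out
  have hAp' : ZpEquivTo p A (Hblock p ((p * ε : ℤ_[p]) : ℚ_[p])) := by simpa using hAp
  obtain ⟨φ, hsurj, hker, hmod, hlift⟩ := hAp'.exists_mod_coords hA.1 hAi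
  replace hmod : ∀ x, (∃ k : ℤ, qf A x = (p : ℚ) * k) ↔ φ x 0 = 0 ∨ φ x 1 = 0 := by
    intro x
    rw [hmod]
    simp
  let χ : Fin 2 → (Fin 3 → ℤ) →+ ZMod p := fun k => (Pi.evalAddMonoidHom _ k.castSucc).comp φ
  have hχ : ∀ k x, x ∈ (χ k).ker ↔ φ x k.castSucc = 0 := fun _ _ => Iff.rfl
  have hidx : ∀ k, (χ k).ker.index = p := by
    intro k
    rw [index_ker_of_surjective, Nat.card_zmod]
    exact (Function.surjective_eval k.castSucc).comp hsurj
  have h := sum_repNum_mul_card hA hB hne (fun k => (χ k).ker) ?_ ?_ ?_ ((p : ℚ) ^ 2 * n)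
    (fun x => if ∃ x', x.1 = (p : ℤ) • x' then 1 + 1 else 1) ?_
  · rw [h, finsum_ite_smul hA hp.ne_zero rfl 1]
    simp
  · intro k l hkl
    by_contra hne
    obtain ⟨x, hx⟩ := hsurj (Pi.single k.castSucc 1)
    have h1 : x ∈ (χ l).ker := by
      rw [hχ, hx, Pi.single_eq_of_ne]
      simpa using Ne.symm hne
    rw [← show (χ k).ker = (χ l).ker from hkl, hχ, hx] at h1
    simp at h1
  · intro i X hX
    have h1 : ((colLattice X : AddSubgroup (Fin 3 → ℤ)) : Set (Fin 3 → ℤ)) ⊆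
        (χ 0).ker ∪ (χ 1).ker := by
      intro x hx
      obtain ⟨y, rfl⟩ := mem_colLattice.mp hx
      exact (hmod _).mp (by rw [qf_mulVec, hX]; exact hBv i y)
    have h2 : (colLattice X).index = p := by
      rw [index_colLattice ((hB i).det_ne_zero_of_gram hX), hdet i X hX]
    rcases AddSubgroupClass.subset_union.mp h1 with h1 | h1
    · exact ⟨0, AddSubgroup.eq_of_le_of_index_eq h1 (by rw [h2, hidx])
        (by rw [hidx]; exact hp.ne_zero)⟩
    · exact ⟨1, AddSubgroup.eq_of_le_of_index_eq h1 (by rw [h2, hidx])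
        (by rw [hidx]; exact hp.ne_zero)⟩
  · intro k
    refine hdown _ (hidx k) fun x hx => (hmod x).mpr ?_
    rw [hχ] at hx
    fin_cases k
    · exact Or.inl hx
    · exact Or.inr hx
  · rintro ⟨x, hx⟩
    have h1 : φ x 0 = 0 ∨ φ x 1 = 0 := (hmod x).mp ⟨p * n, by rw [hx]; push_cast; ring⟩
    have h2 : (∃ x', x = (p : ℤ) • x') ↔ φ x 0 = 0 ∧ φ x 1 = 0 := by
      rw [← hker]
      refine ⟨fun h => by simp [h], fun ⟨h0, h1⟩ => ?_⟩
      have := hlift ε rfl x ⟨n, hx⟩ h0 h1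
      ext i
      fin_cases i <;> assumption
    simp only [hχ, h2]
    rw [Nat.card_eq_fintype_card, Fintype.card_subtype, Finset.card_filter, Fin.sum_univ_two]
    simp only [Fin.castSucc_zero, Fin.castSucc_one]
    by_cases h0 : φ x 0 = 0 <;> by_cases h1' : φ x 1 = 0 <;> simp_all

/-- Two independent linear forms on `𝔽_p³` cutting out an isotropic line of `xy + ez²`; the lines
are indexed by `Option (ZMod p)`. -/
def isotropicForms (e : ZMod p) : Option (ZMod p) → (Fin 3 → ZMod p) →+ ZMod p × ZMod p
  | none =>
    { toFun := fun w => (w 0, w 2)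
      map_zero' := rfl
      map_add' := fun _ _ => rfl }
  | some t =>
    { toFun := fun w => (w 2 - t * w 0, w 1 + e * t ^ 2 * w 0)
      map_zero' := by simp
      map_add' := fun a b => by
        simp only [Pi.add_apply, Prod.mk_add_mk, Prod.mk.injEq]
        constructor <;> ring }

theorem isotropicForms_none_eq_zero {e : ZMod p} {w : Fin 3 → ZMod p} :
    isotropicForms e none w = 0 ↔ w 0 = 0 ∧ w 2 = 0 := by
  simp [isotropicForms]

theorem isotropicForms_some_eq_zero {e t : ZMod p} {w : Fin 3 → ZMod p} :
    isotropicForms e (some t) w = 0 ↔ w 2 = t * w 0 ∧ w 1 = -(e * t ^ 2 * w 0) := by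
  simp [isotropicForms, sub_eq_zero, eq_neg_iff_add_eq_zero]

theorem isotropicForms_surjective (e : ZMod p) (k : Option (ZMod p)) :
    Function.Surjective (isotropicForms e k) := by
  rintro ⟨a, b⟩
  cases k with
  | none => exact ⟨![a, 0, b], by simp [isotropicForms]⟩
  | some t => exact ⟨![0, b, a], by simp [isotropicForms]⟩

theorem isotropic_of_isotropicForms_eq_zero {e : ZMod p} {k : Option (ZMod p)}
    {w : Fin 3 → ZMod p} (h : isotropicForms e k w = 0) : w 0 * w 1 + e * w 2 ^ 2 = 0 := by
  cases k with
  | none =>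
    obtain ⟨h0, h2⟩ := isotropicForms_none_eq_zero.mp h
    simp [h0, h2]
  | some t =>
    obtain ⟨h2, h1⟩ := isotropicForms_some_eq_zero.mp h
    rw [h2, h1]
    ring

theorem exists_isotropicForms_eq_zero {e : ZMod p} (he : e ≠ 0) {w : Fin 3 → ZMod p}
    (h : w 0 * w 1 + e * w 2 ^ 2 = 0) : ∃ k, isotropicForms e k w = 0 := by
  by_cases h0 : w 0 = 0
  · refine ⟨none, isotropicForms_none_eq_zero.mpr ⟨h0, ?_⟩⟩
    simpa [h0, he] using h
  · refine ⟨some (w 2 / w 0), isotropicForms_some_eq_zero.mpr ⟨by field_simp, ?_⟩⟩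
    field_simp
    linear_combination h

theorem isotropicForms_index_unique {e : ZMod p} {w : Fin 3 → ZMod p} (hw : w ≠ 0)
    {k l : Option (ZMod p)} (hk : isotropicForms e k w = 0) (hl : isotropicForms e l w = 0) :
    k = l := by
  have aux : ∀ t, w 0 = 0 → isotropicForms e (some t) w ≠ 0 := by
    intro t h0 h
    obtain ⟨h2, h1⟩ := isotropicForms_some_eq_zero.mp h
    rw [h0, mul_zero] at h2
    rw [h0, mul_zero, neg_zero] at h1
    refine hw (funext fun i => ?_)
    fin_cases i <;> assumption
  cases k with
  | none =>
    cases l with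
    | none => rfl
    | some t => exact absurd hl (aux t (isotropicForms_none_eq_zero.mp hk).1)
  | some s =>
    cases l with
    | none => exact absurd hk (aux s (isotropicForms_none_eq_zero.mp hl).1)
    | some t =>
      have h0 : w 0 ≠ 0 := fun h0 => aux s h0 hk
      have h1 := (isotropicForms_some_eq_zero.mp hk).1
      rw [(isotropicForms_some_eq_zero.mp hl).1] at h1
      rw [mul_right_cancel₀ h0 h1]

theorem isotropicForms_ker_ne {e : ZMod p} {k l : Option (ZMod p)} (h : k ≠ l) :
    ∃ w, isotropicForms e k w = 0 ∧ isotropicForms e l w ≠ 0 := by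
  have : ∃ w, w ≠ 0 ∧ isotropicForms e k w = 0 := by
    cases k with
    | none => exact ⟨![0, 1, 0], fun h => one_ne_zero (congrFun h 1), by simp [isotropicForms]⟩
    | some t =>
      exact ⟨![1, -(e * t ^ 2), t], fun h => one_ne_zero (congrFun h 0), by simp [isotropicForms]⟩
  obtain ⟨w, hw, hk⟩ := this
  exact ⟨w, hk, fun hl => h (isotropicForms_index_unique hw hk hl)⟩

/-- A totally isotropic plane does not exist: a vector isotropic and orthogonal to a nonzero
isotropic vector lies on its line. -/
theorem isotropicForms_eq_zero_of_orthogonal {e : ZMod p} (he : e ≠ 0) {k : Option (ZMod p)}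
    {w z : Fin 3 → ZMod p} (hw : w ≠ 0) (hk : isotropicForms e k w = 0)
    (hz : z 0 * z 1 + e * z 2 ^ 2 = 0)
    (hwz : (w + z) 0 * (w + z) 1 + e * (w + z) 2 ^ 2 = 0) : isotropicForms e k z = 0 := by
  have hq := isotropic_of_isotropicForms_eq_zero hk
  simp only [Pi.add_apply] at hwz
  cases k with
  | none =>
    obtain ⟨h0, h2⟩ := isotropicForms_none_eq_zero.mp hk
    have h1 : w 1 ≠ 0 := by
      intro h1
      refine hw (funext fun i => ?_)
      fin_cases i <;> assumption
    have hz0 : z 0 = 0 := by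
      refine (mul_eq_zero.mp ?_).resolve_left h1
      rw [h0, h2] at hwz
      linear_combination hwz - hz
    refine isotropicForms_none_eq_zero.mpr ⟨hz0, ?_⟩
    simpa [hz0, he] using hz
  | some t =>
    obtain ⟨h2, h1⟩ := isotropicForms_some_eq_zero.mp hk
    have h0 : w 0 ≠ 0 := by
      intro h0
      rw [h0, mul_zero] at h2
      rw [h0, mul_zero, neg_zero] at h1
      refine hw (funext fun i => ?_)
      fin_cases i <;> assumption
    have hlin : z 1 = e * t ^ 2 * z 0 - 2 * e * t * z 2 := by
      apply mul_left_cancel₀ h0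
      rw [h2, h1] at hwz
      linear_combination hwz - hz
    have hsq : (z 2 - t * z 0) ^ 2 = 0 := by
      refine (mul_eq_zero.mp ?_).resolve_left he
      rw [hlin] at hz
      linear_combination hz
    have hz2 : z 2 = t * z 0 := sub_eq_zero.mp (eq_zero_of_pow_eq_zero hsq)
    refine isotropicForms_some_eq_zero.mpr ⟨hz2, ?_⟩
    rw [hlin, hz2]
    ring

theorem index_ker_isotropicForms {e : ZMod p} {φ : (Fin 3 → ℤ) →+ (Fin 3 → ZMod p)}
    (hsurj : Function.Surjective φ) (k : Option (ZMod p)) :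
    ((isotropicForms e k).comp φ).ker.index = p ^ 2 := by
  have h : Function.Surjective ((isotropicForms e k).comp φ) :=
    (isotropicForms_surjective e k).comp hsurj
  rw [index_ker_of_surjective _ h, Nat.card_prod, Nat.card_zmod, sq]

/-- The image of an isometric embedding of determinant `± p²` whose values are divisible by `p` is
the preimage of an isotropic line modulo `p`. -/
theorem exists_colLattice_eq_ker {e : ZMod p} (he : e ≠ 0)
    {φ : (Fin 3 → ℤ) →+ (Fin 3 → ZMod p)} (hsurj : Function.Surjective φ)
    {A B : Matrix (Fin 3) (Fin 3) ℚ}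
    (hmod : ∀ x, (∃ k : ℤ, qf A x = (p : ℚ) * k) ↔ φ x 0 * φ x 1 + e * φ x 2 ^ 2 = 0)
    (hB : PosDef3 B) (hBv : ∀ x, ∃ k : ℤ, qf B x = (p : ℚ) * k)
    {X : Matrix (Fin 3) (Fin 3) ℤ} (hX : (intMap X)ᵀ * A * intMap X = B)
    (hdet : X.det.natAbs = p ^ 2) :
    ∃ k, colLattice X = ((isotropicForms e k).comp φ).ker := by
  have hp : p.Prime := Fact.out
  have hiso : ∀ x ∈ colLattice X, φ x 0 * φ x 1 + e * φ x 2 ^ 2 = 0 := by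
    intro x hx
    obtain ⟨y, rfl⟩ := mem_colLattice.mp hx
    exact (hmod _).mp (by rw [qf_mulVec, hX]; exact hBv y)
  have hXi : (colLattice X).index = p ^ 2 := by
    rw [index_colLattice ((hB).det_ne_zero_of_gram hX), hdet]
  obtain ⟨x, hx, hx0⟩ : ∃ x ∈ colLattice X, φ x ≠ 0 := by
    by_contra! hcon
    have h1 : colLattice X ≤ φ.ker := hcon
    have h2 := AddSubgroup.index_dvd_of_le h1
    rw [hXi, index_ker_of_surjective _ hsurj, Nat.card_fun, Nat.card_zmod, Nat.card_fin,
      Nat.pow_dvd_pow_iff_le_right hp.one_lt] at h2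
    omega
  obtain ⟨k, hk⟩ := exists_isotropicForms_eq_zero he (hiso x hx)
  have hki : ((isotropicForms e k).comp φ).ker.index = p ^ 2 := index_ker_isotropicForms hsurj k
  refine ⟨k, AddSubgroup.eq_of_le_of_index_eq (fun z hz => ?_) (by rw [hXi, hki])
    (by rw [hki]; exact pow_ne_zero 2 hp.ne_zero)⟩
  refine isotropicForms_eq_zero_of_orthogonal he hx0 hk (hiso z hz) ?_
  rw [← map_add]
  exact hiso _ (add_mem hx hz)

theorem exists_mul_eq_smul_one_of_natAbs_det_sq {ε : ℤ_[p]ˣ} {A : Matrix (Fin 3) (Fin 3) ℚ}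
    (hA : PosDef3 A) (hAi : HalfIntegral A)
    (hAp : ZpEquivTo p A (Hblock p ((ε : ℤ_[p]) : ℚ_[p]))) {B : Matrix (Fin 3) (Fin 3) ℚ}
    (hB : PosDef3 B) (hBv : ∀ x, ∃ k : ℤ, qf B x = (p : ℚ) * k)
    {X : Matrix (Fin 3) (Fin 3) ℤ} (hX : (intMap X)ᵀ * A * intMap X = B)
    (hdet : X.det.natAbs = p ^ 2) :
    ∃ Z, X * Z = (p : ℤ) • (1 : Matrix (Fin 3) (Fin 3) ℤ) := by
  obtain ⟨φ, hsurj, hker, hmod, -⟩ := hAp.exists_mod_coords hA.1 hAi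
  obtain ⟨k, hk⟩ := exists_colLattice_eq_ker (ε.isUnit.map PadicInt.toZMod).ne_zero hsurj hmod
    hB hBv hX hdet
  have hle : colLattice ((p : ℤ) • (1 : Matrix (Fin 3) (Fin 3) ℤ)) ≤ colLattice X := by
    intro x hx
    obtain ⟨c, rfl⟩ := mem_colLattice.mp hx
    rw [hk, AddMonoidHom.mem_ker, AddMonoidHom.comp_apply, (hker _).mpr ⟨c, ?_⟩, map_zero]
    rw [Matrix.smul_mulVec, Matrix.one_mulVec]
  obtain ⟨Z, hZ⟩ := exists_mul_of_colLattice_le hle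
  exact ⟨Z, hZ.symm⟩

/-- The adjoint correspondence `X ↦ p X⁻¹` between representations of `pB` by `A` and of `pA`
by `B`. -/
theorem repNum_smul_le {A B : Matrix (Fin 3) (Fin 3) ℚ} (hB : PosDef3 B)
    (h : ∀ X, (intMap X)ᵀ * A * intMap X = (p : ℚ) • B →
      ∃ Z, X * Z = (p : ℤ) • (1 : Matrix (Fin 3) (Fin 3) ℤ)) :
    repNum ((p : ℚ) • B) A ≤ repNum ((p : ℚ) • A) B := by
  have hp0 : (p : ℚ) ≠ 0 := by exact_mod_cast (Fact.out : p.Prime).ne_zero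
  choose f hf using h
  have := hB.finite_rep_form ((p : ℚ) • A)
  refine Nat.card_le_card_of_injective (fun X => ⟨f X.1 X.2, ?_⟩) ?_
  · have h1 : intMap ((p : ℤ) • (1 : Matrix (Fin 3) (Fin 3) ℤ)) = (p : ℚ) • 1 := by
      ext i j
      simp only [intMap, Matrix.map_apply, Matrix.smul_apply, Matrix.one_apply, smul_eq_mul]
      split_ifs <;> simp
    have h2 := gram_mul A X.1 (f X.1 X.2)
    rw [hf X.1 X.2, X.2, h1, gram_smul] at h2
    apply smul_right_injective _ hp0
    simp only
    rw [← h2]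
    simp
  · intro X Y hXY
    have hZ : f X.1 X.2 = f Y.1 Y.2 := congrArg Subtype.val hXY
    have h1 : X.1 * f X.1 X.2 = Y.1 * f X.1 X.2 := by rw [hf X.1 X.2, hZ, hf Y.1 Y.2]
    have hdet : (f X.1 X.2).det ≠ 0 := by
      intro h0
      have := congrArg Matrix.det (hf X.1 X.2)
      rw [Matrix.det_mul, h0, mul_zero, Matrix.det_smul, Matrix.det_one, mul_one] at this
      exact hp0 (by exact_mod_cast eq_zero_of_pow_eq_zero this.symm)
    refine Subtype.ext (Matrix.transpose_injective (Matrix.mulVec_injective (funext fun w =>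
      Matrix.mulVec_injective_of_det_ne_zero (M := (f X.1 X.2)ᵀ)
        (by rwa [Matrix.det_transpose]) ?_)))
    rw [Matrix.mulVec_mulVec, Matrix.mulVec_mulVec, ← Matrix.transpose_mul,
      ← Matrix.transpose_mul, h1]

/-- For a form locally equivalent to `H ⊕ [ε]`, the sublattices of type `ℤ/p ⊕ ℤ/p` carrying values
divisible by `p` correspond to the `p + 1` isotropic lines modulo `p`. -/
theorem sum_rep_up {ι : Type*} [Fintype ι] {ε : ℤ_[p]ˣ} {A : Matrix (Fin 3) (Fin 3) ℚ}
    (hA : PosDef3 A) (hAi : HalfIntegral A)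
    (hAp : ZpEquivTo p A (Hblock p ((ε : ℤ_[p]) : ℚ_[p])))
    {B : ι → Matrix (Fin 3) (Fin 3) ℚ} (hB : ∀ i, PosDef3 (B i))
    (hne : ∀ i j, i ≠ j → ¬ ZEquiv (B i) (B j))
    (hBv : ∀ i x, ∃ k : ℤ, qf (B i) x = (p : ℚ) * k)
    (hdet : ∀ i X, (intMap X)ᵀ * A * intMap X = B i → X.det.natAbs = p ^ 2)
    (hup : ∀ M : AddSubgroup (Fin 3 → ℤ), Nonempty (((Fin 3 → ℤ) ⧸ M) ≃+ (ZMod p × ZMod p)) →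
      M.index = p ^ 2 → (∀ x ∈ M, ∃ k : ℤ, qf A x = (p : ℚ) * k) →
      ∃ i X, (intMap X)ᵀ * A * intMap X = B i ∧ colLattice X = M) (n : ℤ) :
    ∑ i, (repNum (B i) A : ℚ) / (autNum (B i) : ℚ) *
      (Nat.card {y : Fin 3 → ℤ // qf (B i) y = (p : ℚ) * n} : ℚ) =
    (Nat.card {x : Fin 3 → ℤ // qf A x = (p : ℚ) * n} : ℚ) +
      p * (Nat.card {x : Fin 3 → ℤ // (p : ℚ) * qf A x = n} : ℚ) := by
  classical
  have hp : p.Prime := Fact.out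
  have hpq : (p : ℚ) ≠ 0 := by exact_mod_cast hp.ne_zero
  obtain ⟨φ, hsurj, hker, hmod, -⟩ := hAp.exists_mod_coords hA.1 hAi
  set e := PadicInt.toZMod (ε : ℤ_[p])
  have he : e ≠ 0 := (ε.isUnit.map PadicInt.toZMod).ne_zero
  let χ : Option (ZMod p) → (Fin 3 → ℤ) →+ ZMod p × ZMod p := fun k => (isotropicForms e k).comp φ
  have hχ : ∀ k x, x ∈ (χ k).ker ↔ isotropicForms e k (φ x) = 0 := fun _ _ => Iff.rfl
  have hχs : ∀ k, Function.Surjective (χ k) := fun k => (isotropicForms_surjective e k).comp hsurj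
  have hidx : ∀ k, (χ k).ker.index = p ^ 2 := index_ker_isotropicForms hsurj
  have h := sum_repNum_mul_card hA hB hne (fun k => (χ k).ker) ?_ ?_ ?_ ((p : ℚ) * n)
    (fun x => if ∃ x', x.1 = (p : ℤ) • x' then 1 + p else 1) ?_
  · have hn : ∀ x : Fin 3 → ℤ, (p : ℚ) * qf A x = n ↔ qf A x = n / p := fun x => by
      rw [eq_div_iff hpq, mul_comm]
    simp only [hn]
    rw [h, finsum_ite_smul hA hp.ne_zero (c' := n / p) (by field_simp) p]
  · intro k l hkl
    by_contra hne
    obtain ⟨w, hk, hl⟩ := isotropicForms_ker_ne (e := e) hne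
    obtain ⟨x, rfl⟩ := hsurj w
    rw [← hχ] at hk
    rw [Ne, ← hχ, ← show (χ k).ker = (χ l).ker from hkl] at hl
    exact hl hk
  · intro i X hX
    exact exists_colLattice_eq_ker he hsurj hmod (hB i) (hBv i) hX (hdet i X hX)
  · intro k
    refine hup _ ⟨QuotientAddGroup.quotientKerEquivOfSurjective (χ k) (hχs k)⟩ (hidx k)
      fun x hx => (hmod x).mpr ?_
    exact isotropic_of_isotropicForms_eq_zero ((hχ k x).mp hx)
  · rintro ⟨x, hx⟩
    simp only [hχ, ← hker]
    split_ifs with h0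
    · simp [h0, add_comm]
    · obtain ⟨k, hk⟩ := exists_isotropicForms_eq_zero he ((hmod x).mp ⟨n, hx⟩)
      exact Nat.card_eq_one_iff_unique.mpr
        ⟨⟨fun a b => Subtype.ext (isotropicForms_index_unique h0 a.2 b.2)⟩, ⟨k, hk⟩⟩

end Reduction

/-- The Gram matrix of linearly independent rows for a positive diagonal form, with rescaled rows,
is invertible. -/
theorem isUnit_det_mul_transpose_of_rank {ι κ : Type*} [Fintype ι] [DecidableEq ι] [Fintype κ]
    {M N : Matrix ι κ ℚ} {a : ι → ℚ} {b : κ → ℚ} (ha : ∀ i, a i ≠ 0) (hb : ∀ j, 0 < b j)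
    (hN : ∀ i j, N i j = a i * (M i j * b j)) (hrank : M.rank = Fintype.card ι) :
    IsUnit (M * Nᵀ).det := by
  rw [isUnit_iff_ne_zero]
  intro h0
  obtain ⟨w, hw, h⟩ := Matrix.exists_vecMul_eq_zero_iff.mpr h0
  have hli : LinearIndependent ℚ M.row := by
    rw [linearIndependent_iff_card_eq_finrank_span, ← hrank, Matrix.rank_eq_finrank_span_row]
    rfl
  rw [← Matrix.vecMul_vecMul] at h
  have h1 : ∀ i, ∑ j, (w ᵥ* M) j * (M i j * b j) = 0 := by
    intro i
    have h2 := congrFun h i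
    simp only [Matrix.vecMul, dotProduct, Matrix.transpose_apply, hN, Pi.zero_apply] at h2
    refine (mul_eq_zero.mp ?_).resolve_left (ha i)
    rw [← h2, Finset.mul_sum]
    exact Finset.sum_congr rfl fun j _ => by simp only [Matrix.vecMul, dotProduct]; ring
  have h3 : ∑ j, (w ᵥ* M) j ^ 2 * b j = 0 := by
    have : ∑ i, w i * ∑ j, (w ᵥ* M) j * (M i j * b j) = ∑ j, (w ᵥ* M) j ^ 2 * b j := by
      simp only [Finset.mul_sum]
      rw [Finset.sum_comm]
      refine Finset.sum_congr rfl fun j _ => ?_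
      have : (w ᵥ* M) j ^ 2 * b j = (∑ i, w i * M i j) * ((w ᵥ* M) j * b j) := by
        simp only [Matrix.vecMul, dotProduct]
        ring
      rw [this, Finset.sum_mul]
      exact Finset.sum_congr rfl fun i _ => by ring
    rw [← this]
    simp [h1]
  have h4 : w ᵥ* M = 0 := by
    funext j
    have h5 := (Finset.sum_eq_zero_iff_of_nonneg
      fun j _ => mul_nonneg (sq_nonneg _) (hb j).le).mp h3 j (Finset.mem_univ j)
    exact eq_zero_of_pow_eq_zero ((mul_eq_zero.mp h5).resolve_right (hb j).ne')
  refine hw (funext fun i => Fintype.linearIndependent_iff.mp hli w ?_ i)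
  rw [← h4]
  funext j
  simp [Matrix.vecMul, dotProduct]

theorem natAbs_det_of_gram {A B : Matrix (Fin 3) (Fin 3) ℚ} {p m : ℕ}
    (hA : A.det ≠ 0) (h : (p : ℚ) ^ 3 * |B.det| = (m : ℚ) ^ 2 * |A.det|)
    {X : Matrix (Fin 3) (Fin 3) ℤ} (hX : (intMap X)ᵀ * A * intMap X = (p : ℚ) • B) :
    X.det.natAbs = m := by
  have h1 := congrArg Matrix.det hX
  rw [Matrix.det_mul, Matrix.det_mul, Matrix.det_transpose, det_intMap, Matrix.det_smul,
    Fintype.card_fin] at h1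
  have h2 := congrArg abs h1
  rw [abs_mul, abs_mul, abs_mul, abs_of_nonneg (by positivity : (0 : ℚ) ≤ (p : ℚ) ^ 3), h] at h2
  have h3 : (|X.det| : ℚ) ^ 2 = (m : ℚ) ^ 2 := by
    apply mul_right_cancel₀ (abs_ne_zero.mpr hA)
    rw [← h2]
    ring
  have h4 : (|X.det| : ℚ) = m := (sq_eq_sq₀ (abs_nonneg _) (by positivity)).mp h3
  rw [← Int.cast_abs, Int.abs_eq_natAbs] at h4
  exact_mod_cast h4

theorem abs_det_eq_of_local {p : ℕ} [Fact p.Prime] {ε : ℤ_[p]ˣ} {A B : Matrix (Fin 3) (Fin 3) ℚ}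
    (hA : A.det ≠ 0) (hAp : ZpEquivTo p A (Hblock p ((ε : ℤ_[p]) : ℚ_[p])))
    (hBp : ZpEquivTo p B (Hblock p ((p : ℚ_[p]) * ((ε : ℤ_[p]) : ℚ_[p]))))
    (hloc : ∀ q : ℕ, ∀ hq : q.Prime, q ≠ p → @ZqEquiv q ⟨hq⟩ B ((p : ℚ) • A)) :
    |B.det| = p * |A.det| := by
  have hp : p.Prime := Fact.out
  have hpq : (p : ℚ) ≠ 0 := by exact_mod_cast hp.ne_zero
  rw [abs_eq_abs_of_padicNorm_eq (mul_ne_zero hpq hA), abs_mul, Nat.abs_cast]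
  intro q hq
  have : Fact q.Prime := ⟨hq⟩
  by_cases hqp : q = p
  · subst hqp
    have h1 := hAp.norm_det
    have h2 := hBp.norm_det
    rw [norm_mul, mul_assoc, ← h1, ← Rat.cast_natCast, Padic.eq_padicNorm] at h2
    rw [padicNorm.mul]
    exact_mod_cast h2
  · have h1 : padicNorm q p = 1 := padicNorm.padicNorm_of_prime_of_ne hqp
    rw [(hloc q hq hqp).padicNorm_det, Matrix.det_smul, Fintype.card_fin, padicNorm.mul,
      padicNorm.mul, pow_succ, sq, padicNorm.mul, padicNorm.mul, h1]
    simp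

/-- A basis matrix of a sublattice can be chosen so that its Gram matrix is any prescribed
representative of the class of the restricted form. -/
theorem exists_gram_eq_and_colLattice_eq {A C : Matrix (Fin 3) (Fin 3) ℚ} {c : ℚ}
    (hc : c ≠ 0) {Y : Matrix (Fin 3) (Fin 3) ℤ}
    (h : ZEquiv (c⁻¹ • ((intMap Y)ᵀ * A * intMap Y)) C) :
    ∃ X, (intMap X)ᵀ * A * intMap X = c • C ∧ colLattice X = colLattice Y := by
  obtain ⟨U, hU, h⟩ := h
  refine ⟨Y * U, ?_, colLattice_mul_of_isUnit Y hU⟩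
  rw [gram_mul, ← h, gram_smul, smul_inv_smul₀ hc]

/-- Theorem 4.3 of the paper (O-type case, `m = 0`): with `T₁,…,T_u` and `S₁,…,S_v` as in
the text, `𝓜 = (r(T_i^p,S_j)/o(T_i))`, `𝓝 = (r(T_i^p,S_j)/o(S_j))` and `rank 𝓜 = u`,
the matrix `𝓜𝓝ᵗ` is invertible and for every positive `n`:
`p·R(n, spn(T^p)) = 𝓜·R(n,spn(S)) − (𝓜𝓝ᵗ)⁻¹𝓜·(R(p²n,spn(S)) + R(n,spn(S)))`. -/
theorem stmt_16 (p : ℕ) [Fact p.Prime] (hp2 : p ≠ 2) (ε : ℤ_[p]ˣ)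
    (u v : ℕ) (hu : 0 < u)
    (T : Fin u → Matrix (Fin 3) (Fin 3) ℚ) (S : Fin v → Matrix (Fin 3) (Fin 3) ℚ)
    (hT : ∀ i, PosDef3 (T i) ∧ HalfIntegral (T i))
    (hTne : ∀ i j, i ≠ j → ¬ ZEquiv (T i) (T j))
    (hTloc : ∀ i j, ∀ q : ℕ, ∀ hq : q.Prime, @ZqEquiv q ⟨hq⟩ (T i) (T j))
    (hTp : ∀ i, ZpEquivTo p (T i) (Hblock p ((ε : ℤ_[p]) : ℚ_[p])))
    (hS : ∀ j, PosDef3 (S j) ∧ HalfIntegral (S j))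
    (hSne : ∀ i j, i ≠ j → ¬ ZEquiv (S i) (S j))
    (hSp : ∀ j, ZpEquivTo p (S j) (Hblock p ((p : ℚ_[p]) * ((ε : ℤ_[p]) : ℚ_[p]))))
    (hSloc : ∀ j, ∀ q : ℕ, ∀ hq : q.Prime, q ≠ p →
      @ZqEquiv q ⟨hq⟩ (S j) ((p : ℚ) • T ⟨0, hu⟩))
    (hdown : ∀ j, ∀ N : AddSubgroup (Fin 3 → ℤ), N.index = p →
      (∀ x ∈ N, ∃ k : ℤ, qf (S j) x = (p : ℚ) * k) →
      ∀ Y : Matrix (Fin 3) (Fin 3) ℤ, (∀ x, x ∈ N ↔ ∃ c, x = Y.mulVec c) →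
        ∃ i, ZEquiv (((p : ℚ))⁻¹ • ((intMap Y)ᵀ * S j * intMap Y)) (T i))
    (hup : ∀ i, ∀ M : AddSubgroup (Fin 3 → ℤ),
      Nonempty (((Fin 3 → ℤ) ⧸ M) ≃+ (ZMod p × ZMod p)) →
      (∀ x ∈ M, ∃ k : ℤ, qf (T i) x = (p : ℚ) * k) →
      ∀ Y : Matrix (Fin 3) (Fin 3) ℤ, (∀ x, x ∈ M ↔ ∃ c, x = Y.mulVec c) →
        ∃ j, ZEquiv ((intMap Y)ᵀ * T i * intMap Y) ((p : ℚ) • S j))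
    (MM : Matrix (Fin u) (Fin v) ℚ)
    (hMM : MM = Matrix.of fun i j =>
      (repNum ((p : ℚ) • T i) (S j) : ℚ) / (autNum (T i) : ℚ))
    (NN : Matrix (Fin u) (Fin v) ℚ)
    (hNN : NN = Matrix.of fun i j =>
      (repNum ((p : ℚ) • T i) (S j) : ℚ) / (autNum (S j) : ℚ))
    (hrank : MM.rank = u) :
    IsUnit (MM * NNᵀ).det ∧
    ∀ n : ℤ, 0 < n →
      (fun i => (p : ℚ) *
          ((Nat.card {x : Fin 3 → ℤ // (p : ℚ) * qf (T i) x = (n : ℚ)} : ℚ)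
            / (autNum (T i) : ℚ)))
        = MM.mulVec (fun j => (rEval (S j) n : ℚ) / (autNum (S j) : ℚ))
          - ((MM * NNᵀ)⁻¹ * MM).mulVec
              (fun j => (rEval (S j) ((p : ℤ) ^ 2 * n) : ℚ) / (autNum (S j) : ℚ)
                + (rEval (S j) n : ℚ) / (autNum (S j) : ℚ)) := by
  have hp : p.Prime := Fact.out
  have hp0 : (0 : ℚ) < p := by exact_mod_cast hp.pos
  have hval : ∀ A, PosDef3 A → HalfIntegral A → ∀ x, ∃ k : ℤ, qf ((p : ℚ) • A) x = (p : ℚ) * k :=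
    fun A hA hAi x => by
      obtain ⟨k, hk⟩ := hAi.exists_qf_eq hA.1 x
      exact ⟨k, by rw [qf_smul, hk]⟩
  have hdetT : ∀ i, |(T i).det| = |(T ⟨0, hu⟩).det| := fun i =>
    abs_eq_abs_of_padicNorm_eq (hT _).1.det_ne_zero fun q hq =>
      have : Fact q.Prime := ⟨hq⟩
      (hTloc i ⟨0, hu⟩ q hq).padicNorm_det
  have hdetS : ∀ i j, |(S j).det| = p * |(T i).det| := fun i j => by
    rw [hdetT i]
    exact abs_det_eq_of_local (hT _).1.det_ne_zero (hTp _) (hSp j) (hSloc j)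
  have hdetX : ∀ i j X, (intMap X)ᵀ * S j * intMap X = (p : ℚ) • T i → X.det.natAbs = p :=
    fun i j X hX => natAbs_det_of_gram (hS j).1.det_ne_zero (by rw [hdetS i j]; ring) hX
  have hdetY : ∀ i j X, (intMap X)ᵀ * T i * intMap X = (p : ℚ) • S j → X.det.natAbs = p ^ 2 :=
    fun i j X hX => natAbs_det_of_gram (hT i).1.det_ne_zero
      (by rw [hdetS i j]; push_cast; ring) hX
  have hsymm : ∀ i j, repNum ((p : ℚ) • S j) (T i) = repNum ((p : ℚ) • T i) (S j) := fun i j =>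
    le_antisymm
      (repNum_smul_le (hS j).1 fun X hX => exists_mul_eq_smul_one_of_natAbs_det_sq (hT i).1
        (hT i).2 (hTp i) ((hS j).1.smul hp0) (hval _ (hS j).1 (hS j).2) hX (hdetY i j X hX))
      (repNum_smul_le (hT i).1 fun X hX => exists_mul_eq_smul_one_of_natAbs_det (hdetX i j X hX))
  have hoT : ∀ i, (0 : ℚ) < autNum (T i) := fun i => by exact_mod_cast (hT i).1.autNum_pos
  have hoS : ∀ j, (0 : ℚ) < autNum (S j) := fun j => by exact_mod_cast (hS j).1.autNum_pos
  have hunit : IsUnit (MM * NNᵀ).det := by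
    refine isUnit_det_mul_transpose_of_rank (a := fun i => (autNum (T i) : ℚ))
      (b := fun j => (autNum (S j) : ℚ)⁻¹) (fun i => (hoT i).ne') (fun j => inv_pos.mpr (hoS j))
      (fun i j => ?_) (by rw [hrank, Fintype.card_fin])
    have := hoT i
    have := hoS j
    simp only [hMM, hNN, Matrix.of_apply]
    field_simp
  refine ⟨hunit, fun n _ => ?_⟩
  let c : Fin u → ℚ := fun i =>
    (Nat.card {x : Fin 3 → ℤ // qf (T i) x = (p : ℚ) * n} : ℚ) / autNum (T i)
  have hlow : NNᵀ *ᵥ c = fun j => (rEval (S j) ((p : ℤ) ^ 2 * n) : ℚ) / (autNum (S j) : ℚ) +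
      (rEval (S j) n : ℚ) / (autNum (S j) : ℚ) := by
    funext j
    have h := sum_rep_down (hS j).1 (hS j).2 (hSp j) (B := fun i => (p : ℚ) • T i)
      (fun i => (hT i).1.smul hp0) (fun i k hik h => hTne i k hik (h.of_smul hp0.ne'))
      (fun i => hval _ (hT i).1 (hT i).2) (fun i X hX => hdetX i j X hX)
      (fun N hN hv => by
        obtain ⟨Y, rfl⟩ := exists_colLattice_eq N (by rw [hN]; exact hp.ne_zero)
        obtain ⟨i, hi⟩ := hdown j _ hN hv Y fun x => mem_colLattice
        exact ⟨i, exists_gram_eq_and_colLattice_eq hp0.ne' hi⟩) n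
    have hcard : ∀ i y, qf ((p : ℚ) • T i) y = (p : ℚ) ^ 2 * n ↔ qf (T i) y = (p : ℚ) * n := by
      intro i y
      rw [qf_smul, sq, mul_assoc, mul_right_inj' hp0.ne']
    simp only [hcard, autNum_smul hp0.ne'] at h
    simp only [rEval, Int.cast_mul, Int.cast_pow, Int.cast_natCast]
    rw [← add_div, ← h, Finset.sum_div]
    simp only [Matrix.mulVec, dotProduct, Matrix.transpose_apply, hNN, Matrix.of_apply, c]
    exact Finset.sum_congr rfl fun i _ => by ring
  have hupp : ∀ i, (MM *ᵥ fun j => (rEval (S j) n : ℚ) / (autNum (S j) : ℚ)) i = c i + p *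
      ((Nat.card {x : Fin 3 → ℤ // (p : ℚ) * qf (T i) x = (n : ℚ)} : ℚ) / autNum (T i)) := by
    intro i
    have h := sum_rep_up (hT i).1 (hT i).2 (hTp i) (B := fun j => (p : ℚ) • S j)
      (fun j => (hS j).1.smul hp0) (fun j k hjk h => hSne j k hjk (h.of_smul hp0.ne'))
      (fun j => hval _ (hS j).1 (hS j).2) (fun j X hX => hdetY i j X hX)
      (fun M hM hMi hv => by
        obtain ⟨Y, rfl⟩ := exists_colLattice_eq M (by rw [hMi]; exact pow_ne_zero 2 hp.ne_zero)
        obtain ⟨j, hj⟩ := hup i _ hM hv Y fun x => mem_colLattice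
        have hX := exists_gram_eq_and_colLattice_eq one_ne_zero (by rwa [inv_one, one_smul])
        rw [one_smul] at hX
        exact ⟨j, hX⟩) n
    have hcard : ∀ j y, qf ((p : ℚ) • S j) y = (p : ℚ) * n ↔ qf (S j) y = n := by
      intro j y
      rw [qf_smul, mul_right_inj' hp0.ne']
    simp only [hcard, autNum_smul hp0.ne', hsymm] at h
    simp only [c]
    rw [← mul_div_assoc, ← add_div, ← h, Finset.sum_div]
    simp only [Matrix.mulVec, dotProduct, hMM, Matrix.of_apply, rEval]
    exact Finset.sum_congr rfl fun j _ => by ring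
  rw [← hlow, ← Matrix.mulVec_mulVec, Matrix.mulVec_mulVec c MM, Matrix.mulVec_mulVec,
    Matrix.nonsing_inv_mul _ hunit, Matrix.one_mulVec]
  funext i
  rw [Pi.sub_apply, hupp, add_sub_cancel_left]
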